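/- arXiv:1706.03302 — 2 statements merged into one kernel-verified Lean document; each statement's English description precedes it below -/
import Mathlib

section
/- Let k be a field of characteristic 0, t transcendental over k, K a finite extension of k(t), and S = {𝔭₁,…,𝔭_s} a nonempty finite set of primes of K, with ring of S-integers O_{K,S}. Suppose a ∈ O_{K,S} satisfies ord_{𝔭₁}(a) < 0, ord_{𝔭ᵢ}(a) = 0 for i = 2,…,s, and the image of a²−1 in the residue field of 𝔭ᵢ is not a square for i = 2,…,s; assume also that d = a²−1 is not a square in K, and let √d denote a square root of d in the quadratic extension K(√d). Then: (1) for every x, y ∈ O_{K,S} with x² − d·y² = 1 there exists n ∈ ℤ such that x − √d·y = ±(a − √d)^n in K(√d); (2) a − 1 is not a unit of the subring O_{K,S}[√d] of K(√d); and (3) for every nonzero b ∈ ℤ, the element a − √d − b is not a unit of O_{K,S}[√d]. -/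
/-- A Diophantine definition data. -/
def IsDiophantine {R : Type*} [CommRing R] {n : ℕ} (A : Set (Fin n → R)) : Prop :=
  ∃ (m : ℕ) (f : MvPolynomial (Fin n ⊕ Fin m) R),
    ∀ t : Fin n → R, t ∈ A ↔ ∃ x : Fin m → R, MvPolynomial.eval (Sum.elim t x) f = 0

def HasSingleFoldDiophantineDefinition {R : Type*} [CommRing R] {n : ℕ}
    (A : Set (Fin n → R)) : Prop :=
  ∃ (m : ℕ) (f : MvPolynomial (Fin n ⊕ Fin m) R),
    ∀ t : Fin n → R, t ∈ A ↔ ∃! x : Fin m → R, MvPolynomial.eval (Sum.elim t x) f = 0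

def HasFiniteFoldDiophantineDefinition {R : Type*} [CommRing R] {n : ℕ}
    (A : Set (Fin n → R)) : Prop :=
  ∃ (m : ℕ) (f : MvPolynomial (Fin n ⊕ Fin m) R),
    (∀ t : Fin n → R, t ∈ A ↔ ∃ x : Fin m → R, MvPolynomial.eval (Sum.elim t x) f = 0) ∧
    ∀ t : Fin n → R, {x : Fin m → R | MvPolynomial.eval (Sum.elim t x) f = 0}.Finite

/-- A prime of the function field `K` over the constant field `k`, given by its
normalized `ℤ`-valued valuation (with the junk convention `ord 0 = 0`). -/
structure FFPrime (k K : Type*) [Field k] [Field K] [Algebra k K] where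
  ord : K → ℤ
  ord_zero' : ord 0 = 0
  ord_mul : ∀ {x y : K}, x ≠ 0 → y ≠ 0 → ord (x * y) = ord x + ord y
  min_le_ord_add : ∀ {x y : K}, x ≠ 0 → y ≠ 0 → x + y ≠ 0 → min (ord x) (ord y) ≤ ord (x + y)
  ord_algebraMap : ∀ {c : k}, c ≠ 0 → ord (algebraMap k K c) = 0
  exists_uniformizer : ∃ u : K, u ≠ 0 ∧ ord u = 1

namespace FFPrime

variable {k K : Type*} [Field k] [Field K] [Algebra k K]

/-- The image of `a` in the residue field of the prime `v` is a square. -/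
def ResidueIsSquare (v : FFPrime k K) (a : K) : Prop :=
  ∃ b : K, 0 ≤ v.ord b ∧ (a = b ^ 2 ∨ 1 ≤ v.ord (a - b ^ 2))

/-- The prime `v` has degree one: its residue field is (identified with) `k`. -/
def DegreeOne (v : FFPrime k K) : Prop :=
  ∀ x : K, 0 ≤ v.ord x →
    ∃ c : k, x = algebraMap k K c ∨ 1 ≤ v.ord (x - algebraMap k K c)

theorem ord_one (v : FFPrime k K) : v.ord 1 = 0 := by
  have := v.ord_algebraMap (one_ne_zero (α := k))
  simpa using this

theorem ord_neg (v : FFPrime k K) {x : K} (hx : x ≠ 0) : v.ord (-x) = v.ord x := by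
  have h : (-1 : K) ≠ 0 := by norm_num
  have hm : (-x) = (-1) * x := by ring
  have h1 : v.ord (-1 : K) = 0 := by
    have heq : ((algebraMap k K) (-1 : k)) = (-1 : K) := by simp
    have h2 := v.ord_algebraMap (c := (-1 : k)) (by norm_num)
    rwa [heq] at h2
  rw [hm, v.ord_mul h hx, h1, zero_add]

end FFPrime

/-- The ring of `S`-integers of `K`. -/
def SIntegers {k K : Type*} [Field k] [Field K] [Algebra k K]
    (S : Set (FFPrime k K)) : Subring K where
  carrier := {x | ∀ v : FFPrime k K, v ∉ S → 0 ≤ v.ord x}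
  zero_mem' := by intro v hv; rw [v.ord_zero']
  one_mem' := by intro v hv; rw [v.ord_one]
  add_mem' := by
    intro x y hx hy v hv
    by_cases hx0 : x = 0
    · simpa [hx0] using hy v hv
    by_cases hy0 : y = 0
    · simpa [hy0] using hx v hv
    by_cases hxy : x + y = 0
    · rw [hxy, v.ord_zero']
    · exact le_trans (le_min (hx v hv) (hy v hv)) (v.min_le_ord_add hx0 hy0 hxy)
  mul_mem' := by
    intro x y hx hy v hv
    by_cases hx0 : x = 0
    · simp [hx0, v.ord_zero']
    by_cases hy0 : y = 0
    · simp [hy0, v.ord_zero']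
    rw [v.ord_mul hx0 hy0]
    exact add_nonneg (hx v hv) (hy v hv)
  neg_mem' := by
    intro x hx v hv
    by_cases hx0 : x = 0
    · simp [hx0, v.ord_zero']
    rw [v.ord_neg hx0]
    exact hx v hv

open IntermediateField Polynomial WithZero in
/-- The prime attached to a maximal ideal of a Dedekind domain with fraction field `K`. -/
noncomputable def FFPrime.ofHeightOne {k K B : Type*} [Field k] [Field K] [Algebra k K]
    [CommRing B] [IsDedekindDomain B] [Algebra B K] [IsFractionRing B K] [Algebra k B]
    [IsScalarTower k B K] (P : IsDedekindDomain.HeightOneSpectrum B) : FFPrime k K where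
  ord x := -log (P.valuation K x)
  ord_zero' := by simp
  ord_mul {x y} hx hy := by
    rw [map_mul, log_mul (by simpa using hx) (by simpa using hy)]
    ring
  min_le_ord_add {x y} hx hy hxy := by
    have h := (P.valuation K).map_add x y
    have hx' : P.valuation K x ≠ 0 := by simpa using hx
    have hy' : P.valuation K y ≠ 0 := by simpa using hy
    have hxy' : P.valuation K (x + y) ≠ 0 := by simpa using hxy
    rcases le_max_iff.1 h with h | h
    · have := (log_le_log hxy' hx').2 h
      exact (min_le_left _ _).trans (by lia)
    · have := (log_le_log hxy' hy').2 h
      exact (min_le_right _ _).trans (by lia)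
  ord_algebraMap {c} hc := by
    have hu : IsUnit (algebraMap k B c) := (IsUnit.mk0 c hc).map _
    have : P.valuation K (algebraMap B K (algebraMap k B c)) = 1 := by
      rw [IsDedekindDomain.HeightOneSpectrum.valuation_eq_one_iff_notMem]
      exact fun h => P.isPrime.ne_top (Ideal.eq_top_of_isUnit_mem _ h hu)
    rw [IsScalarTower.algebraMap_apply k B K, this]
    simp
  exists_uniformizer := by
    obtain ⟨u, hu⟩ := P.valuation_exists_uniformizer K
    refine ⟨u, fun h => ?_, by simp [hu]⟩
    rw [h, map_zero] at hu
    exact exp_ne_zero hu.symm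

open IntermediateField Polynomial in
theorem finiteDimensional_adjoin_of_transcendental {k K : Type*} [Field k] [Field K] [Algebra k K]
    {t w : K} (ht : Transcendental k t) (hfin : FiniteDimensional k⟮t⟯ K)
    (hw : Transcendental k w) : FiniteDimensional k⟮w⟯ K := by
  let e := RatFunc.algEquivOfTranscendental t ht
  let : Algebra (RatFunc k) K := ((algebraMap k⟮t⟯ K).comp e.toRingHom).toAlgebra
  have : IsScalarTower k (RatFunc k) K := .of_algebraMap_eq fun c => by
    change _ = algebraMap k⟮t⟯ K (e (algebraMap k (RatFunc k) c))
    rw [e.commutes, ← IsScalarTower.algebraMap_apply]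
  have : FiniteDimensional (RatFunc k) K := by
    refine Module.Finite.of_equiv_equiv (A₁ := k⟮t⟯) (B₁ := K) e.symm.toRingEquiv (RingEquiv.refl K) ?_
    ext x
    change algebraMap k⟮t⟯ K (e (e.symm x)) = _
    simp
  exact FunctionField.finiteDimensional_of_adjoin_transcendental hw

open IntermediateField Polynomial algebraAdjoinAdjoin in
theorem FFPrime.exists_ord_pos_of_transcendental {k K : Type*} [Field k] [CharZero k] [Field K]
    [Algebra k K] {t w : K} (ht : Transcendental k t) (hfin : FiniteDimensional k⟮t⟯ K)
    (hw : Transcendental k w) : ∃ v : FFPrime k K, 0 < v.ord w := by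
  have := finiteDimensional_adjoin_of_transcendental ht hfin hw
  let A := Algebra.adjoin k {w}
  let e : k[X] ≃ₐ[k] A := Polynomial.algEquivOfTranscendental k w hw
  have : IsPrincipalIdealRing A := IsPrincipalIdealRing.of_surjective e.toRingHom e.surjective
  let B := integralClosure A K
  have : IsDedekindDomain B := integralClosure.isDedekindDomain A k⟮w⟯ K
  have : IsFractionRing B K :=
    integralClosure.isFractionRing_of_finite_extension (A := A) k⟮w⟯ K
  let wA : A := ⟨w, Algebra.self_mem_adjoin_singleton k w⟩
  have hwA : ¬ IsUnit wA := by
    intro h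
    have h1 : e X = wA := by
      ext
      simp [e, wA, Polynomial.algEquivOfTranscendental]
    rw [← h1] at h
    exact Polynomial.not_isUnit_X ((MulEquiv.isUnit_map e).1 h)
  have hw0 : w ≠ 0 := fun h => hw (h ▸ isAlgebraic_zero)
  have hwB : ¬ IsUnit (algebraMap A B wA) := by
    intro h
    have hloc : IsLocalHom (algebraMap A B) :=
      (algebraMap_isIntegral_iff.mpr inferInstance).isLocalHom
        fun _ _ h => Subtype.ext (congrArg (algebraMap B K) h)
    exact hwA (hloc.map_nonunit wA h)
  obtain ⟨M, hM, hwM⟩ := exists_max_ideal_of_mem_nonunits hwB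
  let P : IsDedekindDomain.HeightOneSpectrum B := ⟨M, hM.isPrime, fun h => by
    rw [h] at hwM
    exact hw0 (congrArg (algebraMap B K) hwM)⟩
  refine ⟨FFPrime.ofHeightOne P, ?_⟩
  have h1 : P.valuation K w < 1 :=
    (P.valuation_lt_one_iff_mem (K := K) (algebraMap A B wA)).2 hwM
  have h2 := (WithZero.log_lt_log (by simpa using hw0) one_ne_zero).2 h1
  rw [WithZero.log_one] at h2
  change 0 < - _
  lia

namespace FFPrime

variable {k K : Type*} [Field k] [Field K] [Algebra k K] (v : FFPrime k K)

theorem mem_sIntegers_compl {x : K} : x ∈ SIntegers ({v}ᶜ : Set (FFPrime k K)) ↔ 0 ≤ v.ord x := by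
  change (∀ u : FFPrime k K, u ∉ ({v}ᶜ : Set (FFPrime k K)) → 0 ≤ u.ord x) ↔ _
  simp

theorem ord_algebraMap_eq_zero (c : k) : v.ord (algebraMap k K c) = 0 := by
  by_cases hc : c = 0
  · rw [hc, map_zero, v.ord_zero']
  · exact v.ord_algebraMap hc

theorem ord_pow {x : K} (hx : x ≠ 0) (n : ℕ) : v.ord (x ^ n) = n * v.ord x := by
  induction n with
  | zero => simp [v.ord_one]
  | succ n ih =>
    rw [pow_succ, v.ord_mul (pow_ne_zero n hx) hx, ih]
    push_cast
    ring

theorem ord_inv {x : K} (hx : x ≠ 0) : v.ord x⁻¹ = -v.ord x := by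
  have h := v.ord_mul hx (inv_ne_zero hx)
  rw [mul_inv_cancel₀ hx, v.ord_one] at h
  lia

theorem ord_mul_pos {x y : K} (hxy : x * y ≠ 0) (hx : 0 < v.ord x) (hy : 0 ≤ v.ord y) :
    0 < v.ord (x * y) := by
  rw [v.ord_mul (left_ne_zero_of_mul hxy) (right_ne_zero_of_mul hxy)]
  lia

theorem ord_nonneg_of_sq {x : K} (h : 0 ≤ v.ord (x ^ 2)) : 0 ≤ v.ord x := by
  by_cases hx : x = 0
  · rw [hx, v.ord_zero']
  · rw [v.ord_pow hx] at h
    push_cast at h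
    lia

theorem not_ord_pos_of_isAlgebraic {x : K} (hx : IsAlgebraic k x) : ¬ 0 < v.ord x := by
  intro hpos
  have hx0 : x ≠ 0 := by
    rintro rfl
    simp [v.ord_zero'] at hpos
  have hc := minpoly.coeff_zero_ne_zero hx.isIntegral hx0
  have hp := minpoly.aeval k x
  generalize minpoly k x = p at hc hp
  rw [← Polynomial.divX_mul_X_add p, map_add, map_mul, Polynomial.aeval_X, Polynomial.aeval_C,
    add_eq_zero_iff_eq_neg] at hp
  have hq : 0 ≤ v.ord (Polynomial.aeval x p.divX) := by
    rw [← mem_sIntegers_compl, Polynomial.aeval_eq_sum_range]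
    refine sum_mem fun i _ => ?_
    rw [Algebra.smul_def]
    exact mul_mem (v.mem_sIntegers_compl.2 (v.ord_algebraMap_eq_zero _).ge)
      (pow_mem (v.mem_sIntegers_compl.2 hpos.le) i)
  have hc' : algebraMap k K (p.coeff 0) ≠ 0 := by simpa using hc
  have hne : x * Polynomial.aeval x p.divX ≠ 0 := by
    intro h
    rw [mul_comm, h, zero_eq_neg] at hp
    exact hc' hp
  have := v.ord_mul_pos hne hpos hq
  rw [mul_comm, hp, v.ord_neg hc', v.ord_algebraMap_eq_zero] at this
  exact this.false

open IntermediateField in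
/-- A function without poles has no zeros. -/
theorem not_ord_pos_of_forall_nonneg [CharZero k] {t : K} (ht : Transcendental k t)
    (hfin : FiniteDimensional k⟮t⟯ K) {x : K} (hx : ∀ u : FFPrime k K, 0 ≤ u.ord x) :
    ¬ 0 < v.ord x := by
  by_cases hxa : IsAlgebraic k x
  · exact v.not_ord_pos_of_isAlgebraic hxa
  have hx0 : x ≠ 0 := fun h => hxa (h ▸ isAlgebraic_zero)
  obtain ⟨u, hu⟩ := exists_ord_pos_of_transcendental ht hfin (w := x⁻¹)
    fun h => hxa (IsAlgebraic.inv_iff.1 h)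
  rw [u.ord_inv hx0] at hu
  have := hx u
  lia

/-- One of the two neighbours of a solution of the Pell equation is smaller at a pole of `a`. -/
theorem pell_descent_step [CharZero K] {a x y : K} (ha : v.ord a < 0) (hy : y ≠ 0)
    (hy' : v.ord y ≤ 0) (h : x ^ 2 - (a ^ 2 - 1) * y ^ 2 = 1) :
    (a * y - x = 0 ∨ v.ord y < v.ord (a * y - x)) ∨
      (a * y + x = 0 ∨ v.ord y < v.ord (a * y + x)) := by
  by_contra! hcon
  obtain ⟨⟨hu, hu'⟩, hw, hw'⟩ := hcon
  have ha0 : a ≠ 0 := by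
    rintro rfl
    simp [v.ord_zero'] at ha
  have hprod : (a * y - x) * (a * y + x) = y ^ 2 + (-1) := by linear_combination -h
  have hsum : (a * y - x) + (a * y + x) = 2 * (a * y) := by ring
  have h2 : v.ord (2 : K) = 0 := by
    have := v.ord_algebraMap_eq_zero 2
    rwa [map_ofNat] at this
  have h20 : (2 : K) ≠ 0 := two_ne_zero
  have h3 := v.min_le_ord_add hu hw (by rw [hsum]; exact mul_ne_zero h20 (mul_ne_zero ha0 hy))
  rw [hsum, v.ord_mul h20 (mul_ne_zero ha0 hy), v.ord_mul ha0 hy, h2] at h3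
  have hne : y ^ 2 + (-1) ≠ 0 := hprod ▸ mul_ne_zero hu hw
  have h4 := v.min_le_ord_add (pow_ne_zero 2 hy) (neg_ne_zero.2 one_ne_zero) hne
  rw [← hprod, v.ord_mul hu hw, v.ord_pow hy, v.ord_neg one_ne_zero, v.ord_one] at h4
  push_cast at h4
  lia

theorem pell_ord_nonneg_of_not_residueIsSquare {d x y : K} (hd : 0 ≤ v.ord d)
    (hns : ¬ v.ResidueIsSquare d) (h : x ^ 2 - d * y ^ 2 = 1) :
    0 ≤ v.ord x ∧ 0 ≤ v.ord y := by
  have hy : 0 ≤ v.ord y := by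
    by_contra! hy
    have hy0 : y ≠ 0 := by
      rintro rfl
      simp [v.ord_zero'] at hy
    have hsq : (x / y) ^ 2 = d + (y⁻¹) ^ 2 := by
      field_simp
      linear_combination h
    have hord : v.ord (y⁻¹ ^ 2) = 2 * -v.ord y := by
      rw [v.ord_pow (inv_ne_zero hy0), v.ord_inv hy0]
      norm_num
    refine hns ⟨x / y, v.ord_nonneg_of_sq ?_, Or.inr ?_⟩
    · rw [hsq, ← mem_sIntegers_compl]
      exact add_mem (v.mem_sIntegers_compl.2 hd) (v.mem_sIntegers_compl.2 (by lia))
    · rw [hsq, sub_add_cancel_left, v.ord_neg (pow_ne_zero 2 (inv_ne_zero hy0))]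
      lia
  refine ⟨v.ord_nonneg_of_sq ?_, hy⟩
  have hx : x ^ 2 = 1 + d * y ^ 2 := by linear_combination h
  rw [hx, ← mem_sIntegers_compl]
  exact add_mem (one_mem _) (mul_mem (v.mem_sIntegers_compl.2 hd)
    (pow_mem (v.mem_sIntegers_compl.2 hy) 2))

end FFPrime

open IntermediateField in
theorem pell_eq_zpow_of_single_pole {k K L : Type*} [Field k] [CharZero k] [Field K] [Algebra k K]
    {t : K} (ht : Transcendental k t) (hfin : FiniteDimensional k⟮t⟯ K) (v : FFPrime k K)
    {a : K} (ha : a ∈ SIntegers ({v} : Set (FFPrime k K))) (hav : v.ord a < 0)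
    [Field L] [Algebra K L] {sd : L} (hsd : sd ^ 2 = algebraMap K L (a ^ 2 - 1)) {x y : K}
    (hx : x ∈ SIntegers ({v} : Set (FFPrime k K))) (hy : y ∈ SIntegers ({v} : Set (FFPrime k K)))
    (h : x ^ 2 - (a ^ 2 - 1) * y ^ 2 = 1) :
    ∃ n : ℤ, algebraMap K L x - sd * algebraMap K L y = (algebraMap K L a - sd) ^ n ∨
      algebraMap K L x - sd * algebraMap K L y = -((algebraMap K L a - sd) ^ n) := by
  have : CharZero K := charZero_of_injective_algebraMap (algebraMap k K).injective
  have ord_nonpos : ∀ z : K, z ∈ SIntegers ({v} : Set (FFPrime k K)) → z ≠ 0 → v.ord z ≤ 0 := by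
    intro z hz hz0
    by_contra! hpos
    refine v.not_ord_pos_of_forall_nonneg ht hfin (fun u => ?_) hpos
    by_cases hu : u = v
    · exact hu ▸ hpos.le
    · exact hz u hu
  have hsd' : sd ^ 2 = algebraMap K L a ^ 2 - 1 := by simpa using hsd
  have hε : (algebraMap K L a - sd) * (algebraMap K L a + sd) = 1 := by
    linear_combination -hsd'
  have hε0 : algebraMap K L a - sd ≠ 0 := left_ne_zero_of_mul_eq_one hε
  have hd : a ^ 2 - 1 ∈ SIntegers ({v} : Set (FFPrime k K)) := sub_mem (pow_mem ha 2) (one_mem _)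
  have key : ∀ N : ℕ, ∀ x y : K, x ∈ SIntegers ({v} : Set (FFPrime k K)) →
      y ∈ SIntegers ({v} : Set (FFPrime k K)) → x ^ 2 - (a ^ 2 - 1) * y ^ 2 = 1 →
      (y = 0 ∨ -v.ord y < N) →
      ∃ n : ℤ, algebraMap K L x - sd * algebraMap K L y = (algebraMap K L a - sd) ^ n ∨
        algebraMap K L x - sd * algebraMap K L y = -((algebraMap K L a - sd) ^ n) := by
    intro N
    induction N with
    | zero =>
      intro x y hx hy h hN
      have hy0 : y = 0 := by
        by_contra hy0
        have := ord_nonpos y hy hy0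
        have := hN.resolve_left hy0
        push_cast at this
        lia
      subst hy0
      refine ⟨0, ?_⟩
      have hx1 : x ^ 2 = 1 := by simpa using h
      rcases eq_or_eq_neg_of_sq_eq_sq x 1 (by rw [hx1, one_pow]) with rfl | rfl <;> simp
    | succ N ih =>
      intro x y hx hy h hN
      by_cases hy0 : y = 0
      · exact ih x y hx hy h (Or.inl hy0)
      have hN' := hN.resolve_left hy0
      push_cast at hN'
      rcases v.pell_descent_step hav hy0 (ord_nonpos y hy hy0) h with hu | hw
      · obtain ⟨n, hn⟩ := ih (x * a - (a ^ 2 - 1) * y) (a * y - x)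
          (sub_mem (mul_mem hx ha) (mul_mem hd hy)) (sub_mem (mul_mem ha hy) hx)
          (by linear_combination h) (hu.imp_right fun hu => by lia)
        refine ⟨n + 1, ?_⟩
        have e : algebraMap K L x - sd * algebraMap K L y =
            (algebraMap K L (x * a - (a ^ 2 - 1) * y) - sd * algebraMap K L (a * y - x)) *
              (algebraMap K L a - sd) := by
          simp only [map_sub, map_mul, map_pow, map_one]
          linear_combination (algebraMap K L x - algebraMap K L a * algebraMap K L y) * hsd'
        rw [zpow_add_one₀ hε0, e]
        exact hn.imp (fun hn => by rw [hn]) fun hn => by rw [hn, neg_mul]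
      · obtain ⟨n, hn⟩ := ih (x * a + (a ^ 2 - 1) * y) (a * y + x)
          (add_mem (mul_mem hx ha) (mul_mem hd hy)) (add_mem (mul_mem ha hy) hx)
          (by linear_combination h) (hw.imp_right fun hw => by lia)
        refine ⟨n - 1, ?_⟩
        have e : algebraMap K L x - sd * algebraMap K L y =
            (algebraMap K L (x * a + (a ^ 2 - 1) * y) - sd * algebraMap K L (a * y + x)) /
              (algebraMap K L a - sd) := by
          rw [eq_div_iff hε0]
          simp only [map_add, map_sub, map_mul, map_pow, map_one]
          linear_combination algebraMap K L y * hsd'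
        rw [zpow_sub_one₀ hε0, e, div_eq_mul_inv]
        exact hn.imp (fun hn => by rw [hn]) fun hn => by rw [hn, neg_mul]
  refine key ((-v.ord y).toNat + 1) x y hx hy h (Or.inr ?_)
  push_cast
  lia

open IntermediateField in
theorem not_mul_eq_one_of_ord_neg {k K : Type*} [Field k] [CharZero k] [Field K] [Algebra k K]
    {t : K} (ht : Transcendental k t) (hfin : FiniteDimensional k⟮t⟯ K) {S : Set (FFPrime k K)}
    {v : FFPrime k K} {w z : K} (hv : v.ord w < 0) (hS : ∀ u ∈ S, u ≠ v → ¬ 0 < u.ord w)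
    (hz : z ∈ SIntegers S) : w * z ≠ 1 := by
  intro h
  have hord : ∀ u : FFPrime k K, u.ord z = -u.ord w := fun u => by
    rw [← u.ord_inv (left_ne_zero_of_mul_eq_one h), eq_inv_of_mul_eq_one_right h]
  refine v.not_ord_pos_of_forall_nonneg ht hfin (x := z) (fun u => ?_) (by rw [hord]; lia)
  by_cases hu : u ∈ S
  · by_cases huv : u = v
    · rw [hord, huv]
      lia
    · have := hS u hu huv
      rw [hord]
      lia
  · exact hz u hu

theorem exists_eq_add_mul_of_mem_closure {K L : Type*} [Field K] [Field L] [Algebra K L]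
    {O : Subring K} {d : K} (hd : d ∈ O) {sd : L} (hsd : sd ^ 2 = algebraMap K L d) {y : L}
    (hy : y ∈ Subring.closure ((algebraMap K L) '' (O : Set K) ∪ {sd})) :
    ∃ x ∈ O, ∃ z ∈ O, y = algebraMap K L x + sd * algebraMap K L z := by
  induction hy using Subring.closure_induction with
  | mem y hy =>
    rcases hy with ⟨x, hx, rfl⟩ | rfl
    · exact ⟨x, hx, 0, O.zero_mem, by simp⟩
    · exact ⟨0, O.zero_mem, 1, O.one_mem, by simp⟩
  | zero => exact ⟨0, O.zero_mem, 0, O.zero_mem, by simp⟩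
  | one => exact ⟨1, O.one_mem, 0, O.zero_mem, by simp⟩
  | add y₁ y₂ _ _ h₁ h₂ =>
    obtain ⟨x₁, hx₁, z₁, hz₁, rfl⟩ := h₁
    obtain ⟨x₂, hx₂, z₂, hz₂, rfl⟩ := h₂
    exact ⟨x₁ + x₂, O.add_mem hx₁ hx₂, z₁ + z₂, O.add_mem hz₁ hz₂, by simp only [map_add]; ring⟩
  | neg y _ h =>
    obtain ⟨x, hx, z, hz, rfl⟩ := h
    exact ⟨-x, O.neg_mem hx, -z, O.neg_mem hz, by simp only [map_neg]; ring⟩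
  | mul y₁ y₂ _ _ h₁ h₂ =>
    obtain ⟨x₁, hx₁, z₁, hz₁, rfl⟩ := h₁
    obtain ⟨x₂, hx₂, z₂, hz₂, rfl⟩ := h₂
    refine ⟨x₁ * x₂ + d * (z₁ * z₂), O.add_mem (O.mul_mem hx₁ hx₂)
      (O.mul_mem hd (O.mul_mem hz₁ hz₂)), x₁ * z₂ + x₂ * z₁,
      O.add_mem (O.mul_mem hx₁ hz₂) (O.mul_mem hx₂ hz₁), ?_⟩
    simp only [map_add, map_mul]
    linear_combination algebraMap K L z₁ * algebraMap K L z₂ * hsd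

theorem eq_zero_and_eq_zero_of_add_mul_sqrt {K L : Type*} [Field K] [Field L] [Algebra K L] {d : K}
    (hd : ¬ IsSquare d) {sd : L} (hsd : sd ^ 2 = algebraMap K L d) {x y : K}
    (h : algebraMap K L x + sd * algebraMap K L y = 0) : x = 0 ∧ y = 0 := by
  have hy : y = 0 := by
    by_contra hy
    refine hd ⟨x / y, (algebraMap K L).injective ?_⟩
    have hy' : algebraMap K L y ≠ 0 := by simpa using hy
    rw [map_mul, map_div₀, ← hsd]
    field_simp
    linear_combination (sd * algebraMap K L y - algebraMap K L x) * h
  refine ⟨?_, hy⟩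
  simpa [hy] using h

namespace FFPrime

variable {k K : Type*} [Field k] [Field K] [Algebra k K] (v : FFPrime k K) {a : K}

theorem not_ord_sub_one_pos (ha : 0 ≤ v.ord a) (hd : ¬ IsSquare (a ^ 2 - 1))
    (hns : ¬ v.ResidueIsSquare (a ^ 2 - 1)) : ¬ 0 < v.ord (a - 1) := by
  intro h
  have e : a ^ 2 - 1 = (a - 1) * (a + 1) := by ring
  have hne : (a - 1) * (a + 1) ≠ 0 := fun h0 => hd ⟨0, by rw [e, h0, mul_zero]⟩
  refine hns ⟨0, v.ord_zero'.ge, Or.inr ?_⟩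
  rw [zero_pow two_ne_zero, sub_zero, e]
  exact v.ord_mul_pos hne h
    (v.mem_sIntegers_compl.1 (add_mem (v.mem_sIntegers_compl.2 ha) (one_mem _)))

theorem not_ord_norm_sub_pos [CharZero k] (hd : ¬ IsSquare (a ^ 2 - 1))
    (hns : ¬ v.ResidueIsSquare (a ^ 2 - 1)) {b : k} (hb : b ≠ 0) :
    ¬ 0 < v.ord (algebraMap k K (1 + b ^ 2) - algebraMap k K (2 * b) * a) := by
  intro h
  set w := algebraMap k K (1 + b ^ 2) - algebraMap k K (2 * b) * a with hw
  have h2b : algebraMap k K (2 * b) ≠ 0 := by simpa using hb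
  have e : a ^ 2 - 1 - algebraMap k K ((1 - b ^ 2) / (2 * b)) ^ 2 =
      w * (algebraMap k K ((4 * b ^ 2)⁻¹) * (w - algebraMap k K (2 * (1 + b ^ 2)))) := by
    have hb' : algebraMap k K b ≠ 0 := by simpa using hb
    have : CharZero K := charZero_of_injective_algebraMap (algebraMap k K).injective
    simp only [hw, map_inv₀, map_div₀, map_mul, map_add, map_sub, map_pow, map_one, map_ofNat]
    field_simp
    ring
  have hne : a ^ 2 - 1 - algebraMap k K ((1 - b ^ 2) / (2 * b)) ^ 2 ≠ 0 := fun h0 =>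
    hd ⟨_, (sub_eq_zero.1 h0).trans (sq _)⟩
  refine hns ⟨_, (v.ord_algebraMap_eq_zero ((1 - b ^ 2) / (2 * b))).ge, Or.inr ?_⟩
  rw [e] at hne ⊢
  have hmem : ∀ c : k, algebraMap k K c ∈ SIntegers ({v}ᶜ : Set (FFPrime k K)) := fun c =>
    v.mem_sIntegers_compl.2 (v.ord_algebraMap_eq_zero c).ge
  exact v.ord_mul_pos hne h (v.mem_sIntegers_compl.1
    (mul_mem (hmem _) (sub_mem (v.mem_sIntegers_compl.2 h.le) (hmem _))))

theorem ord_algebraMap_add_of_neg {x : K} (hx : v.ord x < 0) (c : k) :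
    v.ord (algebraMap k K c + x) < 0 := by
  by_contra! h
  have := v.mem_sIntegers_compl.1 (sub_mem (v.mem_sIntegers_compl.2 h)
    (v.mem_sIntegers_compl.2 (v.ord_algebraMap_eq_zero c).ge))
  rw [add_sub_cancel_left] at this
  lia

end FFPrime

/-- the Pell equation solutions over `O_{K,S}`, and non-units. -/
theorem pell_group_and_nonunits
    {k K : Type*} [Field k] [CharZero k] [Field K] [Algebra k K]
    (t : K) (ht : Transcendental k t)
    (hfin : FiniteDimensional (IntermediateField.adjoin k {t}) K)
    (s : ℕ) (hs : 0 < s) (p : Fin s → FFPrime k K) (hp : Function.Injective p)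
    (a : K) (ha : a ∈ SIntegers (Set.range p))
    (hord1 : (p ⟨0, hs⟩).ord a < 0)
    (hordi : ∀ i : Fin s, i ≠ ⟨0, hs⟩ → (p i).ord a = 0)
    (hsq : ∀ i : Fin s, i ≠ ⟨0, hs⟩ → ¬ (p i).ResidueIsSquare (a ^ 2 - 1))
    (hd : ¬ IsSquare (a ^ 2 - 1))
    (L : Type*) [Field L] [Algebra K L]
    (sd : L) (hsd : sd ^ 2 = algebraMap K L (a ^ 2 - 1))
    (hgen : ∀ z : L, z ∈ Algebra.adjoin K ({sd} : Set L)) :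
    (∀ x y : K, x ∈ SIntegers (Set.range p) → y ∈ SIntegers (Set.range p) →
      x ^ 2 - (a ^ 2 - 1) * y ^ 2 = 1 →
      ∃ n : ℤ, algebraMap K L x - sd * algebraMap K L y = (algebraMap K L a - sd) ^ n ∨
        algebraMap K L x - sd * algebraMap K L y = -((algebraMap K L a - sd) ^ n)) ∧
    (¬ ∃ y ∈ Subring.closure
        ((algebraMap K L) '' (SIntegers (Set.range p) : Set K) ∪ {sd}),
      algebraMap K L (a - 1) * y = 1) ∧
    (∀ b : ℤ, b ≠ 0 → ¬ ∃ y ∈ Subring.closure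
        ((algebraMap K L) '' (SIntegers (Set.range p) : Set K) ∪ {sd}),
      (algebraMap K L a - sd - (b : L)) * y = 1) := by
  set S := Set.range p
  set v := p ⟨0, hs⟩
  have hother : ∀ u ∈ S, u ≠ v → u.ord a = 0 ∧ ¬ u.ResidueIsSquare (a ^ 2 - 1) := by
    rintro _ ⟨i, rfl⟩ hi
    have hi' : i ≠ ⟨0, hs⟩ := fun h => hi (by rw [h])
    exact ⟨hordi i hi', hsq i hi'⟩
  have hdS : a ^ 2 - 1 ∈ SIntegers S := sub_mem (pow_mem ha 2) (one_mem _)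
  have hvS : ∀ c : K, c ∈ SIntegers S → (∀ u ∈ S, u ≠ v → 0 ≤ u.ord c) →
      c ∈ SIntegers ({v} : Set (FFPrime k K)) := by
    intro c hc h u hu
    by_cases huS : u ∈ S
    · exact h u huS hu
    · exact hc u huS
  refine ⟨?_, ?_, ?_⟩
  · intro x y hx hy h
    have hxy : ∀ u ∈ S, u ≠ v → 0 ≤ u.ord x ∧ 0 ≤ u.ord y := by
      intro u hu huv
      obtain ⟨h0, hns⟩ := hother u hu huv
      refine u.pell_ord_nonneg_of_not_residueIsSquare ?_ hns h
      exact u.mem_sIntegers_compl.1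
        (sub_mem (pow_mem (u.mem_sIntegers_compl.2 h0.ge) 2) (one_mem _))
    exact pell_eq_zpow_of_single_pole ht hfin v
      (hvS a ha fun u hu huv => (hother u hu huv).1.ge) hord1 hsd
      (hvS x hx fun u hu huv => (hxy u hu huv).1) (hvS y hy fun u hu huv => (hxy u hu huv).2) h
  · rintro ⟨y, hy, h⟩
    obtain ⟨x, hx, z, hz, rfl⟩ := exists_eq_add_mul_of_mem_closure hdS hsd hy
    have h0 : algebraMap K L ((a - 1) * x - 1) + sd * algebraMap K L ((a - 1) * z) = 0 := by
      rw [map_sub, map_mul, map_mul, map_one]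
      linear_combination h
    have h1 := sub_eq_zero.1 (eq_zero_and_eq_zero_of_add_mul_sqrt hd hsd h0).1
    refine not_mul_eq_one_of_ord_neg ht hfin (v := v) ?_ (fun u hu huv => ?_) hx h1
    · have := v.ord_algebraMap_add_of_neg hord1 (-1)
      rwa [map_neg, map_one, neg_add_eq_sub] at this
    · obtain ⟨h0, hns⟩ := hother u hu huv
      exact u.not_ord_sub_one_pos h0.ge hd hns
  · rintro b hb ⟨y, hy, h⟩
    obtain ⟨x, hx, z, hz, rfl⟩ := exists_eq_add_mul_of_mem_closure hdS hsd hy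
    have hb' : (b : k) ≠ 0 := by exact_mod_cast hb
    have h0 : algebraMap K L ((a - b) * x - (a ^ 2 - 1) * z - 1) +
        sd * algebraMap K L ((a - b) * z - x) = 0 := by
      simp only [map_sub, map_mul, map_one, map_pow, map_intCast] at hsd ⊢
      linear_combination h + algebraMap K L z * hsd
    obtain ⟨h1, h2⟩ := eq_zero_and_eq_zero_of_add_mul_sqrt hd hsd h0
    have hnorm : (algebraMap k K (1 + (b : k) ^ 2) - algebraMap k K (2 * b) * a) *
        (x ^ 2 - (a ^ 2 - 1) * z ^ 2) = 1 := by
      simp only [map_add, map_mul, map_one, map_pow, map_intCast, map_ofNat]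
      obtain rfl : x = (a - b) * z := by linear_combination -h2
      linear_combination ((a - b) * ((a - b) * z) - (a ^ 2 - 1) * z + 1) * h1
    refine not_mul_eq_one_of_ord_neg ht hfin (v := v) ?_ (fun u hu huv => ?_)
      (sub_mem (pow_mem hx 2) (mul_mem hdS (pow_mem hz 2))) hnorm
    · have ha0 : a ≠ 0 := by
        intro h
        rw [h, v.ord_zero'] at hord1
        exact hord1.false
      have hc : algebraMap k K (2 * b) ≠ 0 := by simpa [-map_mul, -map_intCast] using hb'
      rw [sub_eq_add_neg]
      refine v.ord_algebraMap_add_of_neg ?_ _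
      rwa [v.ord_neg (mul_ne_zero hc ha0), v.ord_mul hc ha0, v.ord_algebraMap_eq_zero, zero_add]
    · exact u.not_ord_norm_sub_pos hd (hother u hu huv).2 hb'
end

section
/- Let k be a field of characteristic 0, t transcendental over k, and K a finite extension of k(t). Let a, b ∈ k be such that the quadratic form X² − aY² − bZ² + abW² is anisotropic over k, i.e., the only solution of x² − ay² − bz² + abw² = 0 with x,y,z,w ∈ k is x = y = z = w = 0. Let 𝔗 be a prime of K of degree 1, i.e., a valuation subring V of K with k ⊆ V ≠ K whose residue field equals k (the composition of the inclusion k → V with the quotient map to the residue field is an isomorphism), and let ord_𝔗 be the associated normalized ℤ-valued valuation. If h ∈ K has ord_𝔗(h) odd, then the equation X² − aY² − bZ² + abW² = h has no solution X, Y, Z, W ∈ K. -/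
namespace FFPrime

variable {k K : Type*} [Field k] [Field K] [Algebra k K]

/-- `x` has order at least `n` at `v`, where `0` is regarded as having infinite order. -/
def OrdGE (v : FFPrime k K) (n : ℤ) (x : K) : Prop :=
  x = 0 ∨ n ≤ v.ord x

variable {v : FFPrime k K} {m n : ℤ} {x y : K}

theorem OrdGE.mono (hmn : m ≤ n) (hx : v.OrdGE n x) : v.OrdGE m x :=
  hx.imp_right hmn.trans

theorem OrdGE.add (hx : v.OrdGE n x) (hy : v.OrdGE n y) : v.OrdGE n (x + y) := by
  by_cases hx0 : x = 0
  · rwa [hx0, zero_add]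
  by_cases hy0 : y = 0
  · rwa [hy0, add_zero]
  by_cases hxy : x + y = 0
  · exact Or.inl hxy
  · exact Or.inr ((le_min (hx.resolve_left hx0) (hy.resolve_left hy0)).trans
      (v.min_le_ord_add hx0 hy0 hxy))

theorem OrdGE.neg (hx : v.OrdGE n x) : v.OrdGE n (-x) := by
  by_cases hx0 : x = 0
  · exact Or.inl (by simp [hx0])
  · exact Or.inr ((hx.resolve_left hx0).trans_eq (v.ord_neg hx0).symm)

theorem OrdGE.sub (hx : v.OrdGE n x) (hy : v.OrdGE n y) : v.OrdGE n (x - y) := by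
  simpa [sub_eq_add_neg] using hx.add hy.neg

theorem OrdGE.mul (hx : v.OrdGE m x) (hy : v.OrdGE n y) : v.OrdGE (m + n) (x * y) := by
  by_cases hx0 : x = 0
  · exact Or.inl (by simp [hx0])
  by_cases hy0 : y = 0
  · exact Or.inl (by simp [hy0])
  refine Or.inr ?_
  rw [v.ord_mul hx0 hy0]
  exact add_le_add (hx.resolve_left hx0) (hy.resolve_left hy0)

theorem ordGE_zero_algebraMap (v : FFPrime k K) (c : k) : v.OrdGE 0 (algebraMap k K c) := by
  by_cases hc : c = 0
  · exact Or.inl (by simp [hc])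
  · exact Or.inr (v.ord_algebraMap hc).ge

theorem eq_zero_of_ordGE_one_algebraMap {c : k} (hc : v.OrdGE 1 (algebraMap k K c)) : c = 0 := by
  by_contra h0
  rcases hc with hc | hc
  · exact h0 (by simpa using hc)
  · rw [v.ord_algebraMap h0] at hc
    omega

theorem DegreeOne.exists_ordGE_one_sub (hdeg : v.DegreeOne) (hx : v.OrdGE 0 x) :
    ∃ c : k, v.OrdGE 1 (x - algebraMap k K c) := by
  have hx' : 0 ≤ v.ord x := hx.elim (fun h => by rw [h, v.ord_zero']) id
  obtain ⟨c, hc⟩ := hdeg x hx'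
  exact ⟨c, hc.imp_left sub_eq_zero.mpr⟩

/-- If `x` is congruent to a constant `c` modulo the prime `v`, then `x ^ 2` is congruent to
`c ^ 2`. -/
theorem OrdGE.sq_sub_sq {c : k} (hx : v.OrdGE 0 x) (hc : v.OrdGE 1 (x - algebraMap k K c)) :
    v.OrdGE 1 (x ^ 2 - algebraMap k K c ^ 2) := by
  rw [_root_.sq_sub_sq]
  exact (hx.add (v.ordGE_zero_algebraMap c)).mul hc

/-- An element congruent to a nonzero constant modulo `v` has order zero. -/
theorem ord_eq_zero_of_ordGE_one_sub {c : k} (hc : c ≠ 0)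
    (hx : v.OrdGE 1 (x - algebraMap k K c)) : x ≠ 0 ∧ v.ord x = 0 := by
  have hx1 : ¬ v.OrdGE 1 x := fun h =>
    hc (eq_zero_of_ordGE_one_algebraMap (by simpa using h.sub hx))
  have hx0 : v.OrdGE 0 x := by
    simpa using (hx.mono zero_le_one).add (v.ordGE_zero_algebraMap c)
  simp only [OrdGE, not_or, not_le] at hx1 hx0
  have := hx0.resolve_left hx1.1
  exact ⟨hx1.1, by omega⟩

/-- Among finitely many elements, not all zero, one of them divides all others in the
valuation ring of `v`. -/
theorem exists_forall_ordGE_zero_div {ι : Type*} [Finite ι] (v : FFPrime k K) {f : ι → K}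
    (hf : ∃ i, f i ≠ 0) : ∃ i, f i ≠ 0 ∧ ∀ j, v.OrdGE 0 (f j / f i) := by
  obtain ⟨i, hi, hmin⟩ := Set.exists_min_image {i | f i ≠ 0} (fun i => v.ord (f i))
    (Set.toFinite _) hf
  refine ⟨i, hi, fun j => ?_⟩
  by_cases hj : f j = 0
  · exact Or.inl (by simp [hj])
  · have h := v.ord_mul (div_ne_zero hj hi) hi
    rw [div_mul_cancel₀ _ hi] at h
    have := hmin j hj
    exact Or.inr (by omega)

end FFPrime

/-- an anisotropic quaternary form over the constants does not
represent any element of odd order at a degree-one prime. -/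
theorem anisotropic_form_no_odd_order_value
    {k K : Type*} [Field k] [CharZero k] [Field K] [Algebra k K]
    (t : K) (ht : Transcendental k t)
    (hfin : FiniteDimensional (IntermediateField.adjoin k {t}) K)
    (a b : k)
    (haniso : ∀ x y z w : k,
      x ^ 2 - a * y ^ 2 - b * z ^ 2 + a * b * w ^ 2 = 0 → x = 0 ∧ y = 0 ∧ z = 0 ∧ w = 0)
    (v : FFPrime k K) (hdeg : v.DegreeOne)
    (h : K) (hodd : Odd (v.ord h)) :
    ¬ ∃ X Y Z W : K,
      X ^ 2 - algebraMap k K a * Y ^ 2 - algebraMap k K b * Z ^ 2 +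
        algebraMap k K a * algebraMap k K b * W ^ 2 = h := by
  rintro ⟨X, Y, Z, W, hq⟩
  have hne : ∃ i, ![X, Y, Z, W] i ≠ 0 := by
    by_contra! h0
    have hX : X = 0 := h0 0
    have hY : Y = 0 := h0 1
    have hZ : Z = 0 := h0 2
    have hW : W = 0 := h0 3
    have hh : h = 0 := by rw [← hq, hX, hY, hZ, hW]; ring
    rw [hh, v.ord_zero'] at hodd
    exact absurd hodd (by decide)
  obtain ⟨i, hd, hint⟩ := v.exists_forall_ordGE_zero_div hne
  choose c hc using fun j => hdeg.exists_ordGE_one_sub (hint j)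
  have hci : c i ≠ 0 := by
    intro h0
    have h1 := hc i
    rw [h0, map_zero, sub_zero, div_self hd, ← map_one (algebraMap k K)] at h1
    exact one_ne_zero (FFPrime.eq_zero_of_ordGE_one_algebraMap h1)
  generalize ![X, Y, Z, W] i = d at hd hint hc
  have hqc : c 0 ^ 2 - a * c 1 ^ 2 - b * c 2 ^ 2 + a * b * c 3 ^ 2 ≠ 0 := by
    intro h0
    obtain ⟨h0, h1, h2, h3⟩ := haniso _ _ _ _ h0
    fin_cases i <;> contradiction
  have hsq := fun j => (hint j).sq_sub_sq (hc j)
  have hscale (e : k) (j : Fin 4) := (v.ordGE_zero_algebraMap e).mul (hsq j)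
  have hcong := (((hsq 0).sub (hscale a 1)).sub (hscale b 2)).add (hscale (a * b) 3)
  obtain ⟨hy0, hyord⟩ := FFPrime.ord_eq_zero_of_ordGE_one_sub (v := v)
    (x := (X / d) ^ 2 - algebraMap k K a * (Y / d) ^ 2 - algebraMap k K b * (Z / d) ^ 2 +
      algebraMap k K a * algebraMap k K b * (W / d) ^ 2) hqc (by
        convert hcong using 1
        simp
        ring)
  have hfac : h = d * d * ((X / d) ^ 2 - algebraMap k K a * (Y / d) ^ 2 -
      algebraMap k K b * (Z / d) ^ 2 +
      algebraMap k K a * algebraMap k K b * (W / d) ^ 2) := by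
    rw [← hq]
    field_simp
  rw [hfac, v.ord_mul (mul_ne_zero hd hd) hy0, v.ord_mul hd hd, hyord, add_zero] at hodd
  exact Int.not_even_iff_odd.mpr hodd ⟨_, rfl⟩
end
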